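/- Let p ≥ 5 be a prime and set n = 2^(p-1). Let A, B : ℕ → ℕ → ℤ be double-indexed sequences satisfying A_r(0) = 1 for all r and A_r(k) = (p - r - k)·A_r(k-1) + 4·(p - 2r)·A_{r+1}(k-1) whenever k ≥ 1 and r + k ≤ ⌊p/2⌋, and B_r(0) = 1 for all r and B_r(k) = -2·(n - r - k)·B_r(k-1) - 2·(n - 2r - 1)·B_{r+1}(k-1) whenever k ≥ 1 and r + k ≤ n/2. Then ∏_{j=1}^{⌊p/2⌋}(p - j) divides A_0(⌊p/2⌋) and ∏_{j=1}^{n/2}(n - j) divides B_0(n/2), and moreover 2^p - 1 is prime if and only if A_0(⌊p/2⌋)/∏_{j=1}^{⌊p/2⌋}(p - j) divides B_0(n/2)/∏_{j=1}^{n/2}(n - j). -/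

import Mathlib

open Finset Nat

/-- The coefficient `(2j + m) / (j + m) * (j + m).choose j` of `q ^ j * x ^ m` in the Lucas
polynomial of degree `2j + m`, with value `2` at the origin. -/
def lucasCoeff : ℕ → ℕ → ℕ
  | 0, 0 => 2
  | 0, _ + 1 => 1
  | _ + 1, 0 => 2
  | j + 1, m + 1 => lucasCoeff (j + 1) m + lucasCoeff j (m + 1)

theorem lucasCoeff_zero_right (j : ℕ) : lucasCoeff j 0 = 2 := by
  cases j <;> simp [lucasCoeff]

theorem lucasCoeff_zero_succ (m : ℕ) : lucasCoeff 0 (m + 1) = 1 := by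
  simp [lucasCoeff]

theorem lucasCoeff_mul_factorial (j m : ℕ) :
    lucasCoeff j m * j ! * m ! * (j + m) = (2 * j + m) * (j + m)! := by
  induction j generalizing m with
  | zero => cases m <;> simp [lucasCoeff]; ring
  | succ j ihj =>
    induction m with
    | zero => simp [lucasCoeff]; ring
    | succ m ihm =>
      have h₁ := ihj (m + 1)
      have h₂ : (j + 1 + m)! = (j + 1 + m) * (j + m)! := by
        rw [show j + 1 + m = j + m + 1 by ring, factorial_succ]
      rw [show j + (m + 1) = j + 1 + m by ring] at h₁
      rw [show j + 1 + (m + 1) = j + 1 + m + 1 by ring, factorial_succ (j + 1 + m), lucasCoeff]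
      apply Nat.eq_of_mul_eq_mul_left (show 0 < j + 1 + m by lia)
      simp only [factorial_succ] at *
      linear_combination (j + m + 2) * (m + 1) * ihm + (j + m + 2) * (j + 1) * h₁

/-- The Lucas polynomial of degree `2h` as a polynomial in `y = x ^ 2` and `q`. -/
def lucasEven (y q : ℤ) (h : ℕ) : ℤ :=
  ∑ ij ∈ antidiagonal h, lucasCoeff ij.2 (2 * ij.1) * q ^ ij.2 * y ^ ij.1

/-- The Lucas polynomial of degree `2h + 1`, divided by `x`, as a polynomial in `y = x ^ 2`
and `q`. -/
def lucasOdd (y q : ℤ) (h : ℕ) : ℤ :=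
  ∑ ij ∈ antidiagonal h, lucasCoeff ij.2 (2 * ij.1 + 1) * q ^ ij.2 * y ^ ij.1

theorem lucasEven_succ (y q : ℤ) (h : ℕ) :
    lucasEven y q (h + 1) = y * lucasOdd y q h + q * lucasEven y q h := by
  unfold lucasEven lucasOdd
  cases h with
  | zero => simp [Nat.sum_antidiagonal_succ, lucasCoeff]; ring
  | succ h =>
    rw [Nat.sum_antidiagonal_succ, Nat.sum_antidiagonal_succ', Nat.sum_antidiagonal_succ' (n := h),
      Nat.sum_antidiagonal_succ (n := h) (f := fun ij : ℕ × ℕ ↦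
        (lucasCoeff ij.2 (2 * ij.1) * q ^ ij.2 * y ^ ij.1 : ℤ))]
    have key : ∀ ij : ℕ × ℕ, (lucasCoeff (ij.2 + 1) (2 * (ij.1 + 1)) * q ^ (ij.2 + 1) *
        y ^ (ij.1 + 1) : ℤ) = y * (lucasCoeff (ij.2 + 1) (2 * ij.1 + 1) * q ^ (ij.2 + 1) * y ^ ij.1)
        + q * (lucasCoeff ij.2 (2 * (ij.1 + 1)) * q ^ ij.2 * y ^ (ij.1 + 1)) := by
      intro ij
      rw [show 2 * (ij.1 + 1) = 2 * ij.1 + 1 + 1 by ring, lucasCoeff]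
      push_cast
      ring
    simp only [key, sum_add_distrib, ← mul_sum, mul_zero, lucasCoeff_zero_right,
      show 2 * (h + 1 + 1) = 2 * (h + 1) + 1 + 1 by ring, lucasCoeff_zero_succ]
    push_cast
    ring

theorem lucasOdd_succ (y q : ℤ) (h : ℕ) :
    lucasOdd y q (h + 1) = lucasEven y q (h + 1) + q * lucasOdd y q h := by
  unfold lucasEven lucasOdd
  rw [Nat.sum_antidiagonal_succ', Nat.sum_antidiagonal_succ']
  have key : ∀ ij : ℕ × ℕ, (lucasCoeff (ij.2 + 1) (2 * ij.1 + 1) * q ^ (ij.2 + 1) *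
      y ^ ij.1 : ℤ) = lucasCoeff (ij.2 + 1) (2 * ij.1) * q ^ (ij.2 + 1) * y ^ ij.1
      + q * (lucasCoeff ij.2 (2 * ij.1 + 1) * q ^ ij.2 * y ^ ij.1) := by
    intro ij
    rw [lucasCoeff]
    push_cast
    ring
  simp only [key, sum_add_distrib, ← mul_sum, lucasCoeff_zero_succ,
    show 2 * (h + 1) = 2 * h + 1 + 1 by ring]
  push_cast
  ring

theorem lucasEven_and_lucasOdd_one_two (h : ℕ) :
    lucasEven 1 2 h = 2 ^ (2 * h) + 1 ∧ lucasOdd 1 2 h = 2 ^ (2 * h + 1) - 1 := by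
  induction h with
  | zero => simp [lucasEven, lucasOdd, lucasCoeff]
  | succ h ih =>
    rw [lucasOdd_succ, lucasEven_succ, ih.1, ih.2]
    constructor <;> ring

theorem lucasEven_and_lucasOdd_two_one (h : ℕ) :
    lucasEven 2 1 h = 2 * ((⟨2, 1⟩ : ℤ√3) ^ h).re ∧
      lucasOdd 2 1 h = ((⟨2, 1⟩ : ℤ√3) ^ h).re + 3 * ((⟨2, 1⟩ : ℤ√3) ^ h).im := by
  induction h with
  | zero => simp [lucasEven, lucasOdd, lucasCoeff]
  | succ h ih =>
    rw [lucasOdd_succ, lucasEven_succ, ih.1, ih.2, pow_succ]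
    simp only [Zsqrtd.re_mul, Zsqrtd.im_mul]
    constructor <;> ring

theorem LucasLehmer.s_eq_two_mul_re (i : ℕ) :
    LucasLehmer.s i = 2 * ((⟨2, 1⟩ : ℤ√3) ^ 2 ^ i).re := by
  induction i with
  | zero => simp [LucasLehmer.s]
  | succ i ih =>
    have hnorm : (((⟨2, 1⟩ : ℤ√3) ^ 2 ^ i)).norm = 1 := by
      have hpow := map_pow (Zsqrtd.normMonoidHom (d := 3)) ⟨2, 1⟩ (2 ^ i)
      simpa [Zsqrtd.normMonoidHom, Zsqrtd.norm_def] using hpow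
    rw [LucasLehmer.s, ih, pow_succ 2 i, pow_mul, sq (_ ^ 2 ^ i), Zsqrtd.re_mul]
    rw [Zsqrtd.norm_def] at hnorm
    linear_combination 2 * hnorm

theorem sum_paths_of_recurrence (N d a c : ℤ) (M : ℕ) (F : ℕ → ℕ → ℤ) (hF0 : ∀ r, F r 0 = 1)
    (hF : ∀ r k, 1 ≤ k → r + k ≤ M →
      F r k = a * (N - r - k) * F r (k - 1) + c * (N - d - 2 * r) * F (r + 1) (k - 1))
    (r k : ℕ) (hrk : r + k ≤ M) :
    F r k = ∑ ij ∈ antidiagonal k, (k.choose ij.1 : ℤ) *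
      (a ^ ij.1 * c ^ ij.2 * (∏ t ∈ range ij.1, (N - (r + k) + t)) *
        ∏ t ∈ range ij.2, (N - d - 2 * (r + t))) := by
  induction k generalizing r with
  | zero => simp [hF0]
  | succ k ih =>
    rw [hF r (k + 1) (by lia) hrk, Nat.add_sub_cancel, ih r (by lia), ih (r + 1) (by lia),
      sum_antidiagonal_choose_succ_mul (fun i j : ℕ ↦ a ^ i * c ^ j *
        (∏ t ∈ range i, (N - (r + (k + 1 : ℕ)) + t)) * ∏ t ∈ range j, (N - d - 2 * (r + t))),
      mul_sum, mul_sum, add_comm]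
    congr 1
    · refine sum_congr rfl fun ij _ ↦ ?_
      simp only [prod_range_succ']
      push_cast
      simp only [show ∀ t : ℤ, (r : ℤ) + 1 + t = r + (t + 1) by intro t; ring]
      ring
    · refine sum_congr rfl fun ij hij ↦ ?_
      rw [← choose_symm_of_eq_add (mem_antidiagonal.1 hij).symm]
      simp only [prod_range_succ']
      push_cast
      simp only [show ∀ t : ℤ, N - (r + (k + 1)) + (t + 1) = N - (r + k) + t by intro t; ring]
      ring

theorem prod_even_mul_factorial (i j : ℕ) :
    (∏ t ∈ range j, (2 * ((i + j : ℕ) : ℤ) - 1 - 2 * t)) * 2 ^ j * ((i + j).choose j) * j ! *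
      (2 * i)! = (2 * (i + j))! := by
  induction j with
  | zero => simp
  | succ j ih =>
    have hc : ((i + j + 1 : ℕ) : ℤ) * (i + j).choose j = (i + j + 1).choose (j + 1) * (j + 1) := by
      exact_mod_cast add_one_mul_choose_eq (i + j) j
    rw [prod_range_succ', ← add_assoc, show 2 * (i + j + 1) = 2 * (i + j) + 1 + 1 by ring,
      factorial_succ (2 * (i + j) + 1), factorial_succ (2 * (i + j)), factorial_succ j]
    push_cast at ih hc ⊢
    rw [← ih]
    simp only [show ∀ t : ℤ, 2 * ((i : ℤ) + j + 1) - 1 - 2 * (t + 1) = 2 * (i + j) - 1 - 2 * t by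
      intro t; ring]
    linear_combination (-(2 * (i + j) + 1) * 2 ^ (j + 1) * j ! * (2 * i)! *
      ∏ t ∈ range j, (2 * ((i : ℤ) + j) - 1 - 2 * t)) * hc

theorem prod_odd_mul_factorial (i j : ℕ) :
    (∏ t ∈ range j, (2 * ((i + j : ℕ) : ℤ) + 1 - 2 * t)) * 2 ^ j * ((i + j).choose j) * j ! *
      (2 * i + 1)! = (2 * (i + j) + 1)! := by
  induction j with
  | zero => simp
  | succ j ih =>
    have hc : ((i + j + 1 : ℕ) : ℤ) * (i + j).choose j = (i + j + 1).choose (j + 1) * (j + 1) := by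
      exact_mod_cast add_one_mul_choose_eq (i + j) j
    rw [prod_range_succ', ← add_assoc, show 2 * (i + j + 1) + 1 = 2 * (i + j) + 1 + 1 + 1 by ring,
      factorial_succ (2 * (i + j) + 1 + 1), factorial_succ (2 * (i + j) + 1), factorial_succ j]
    push_cast at ih hc ⊢
    rw [← ih]
    simp only [show ∀ t : ℤ, 2 * ((i : ℤ) + j + 1) + 1 - 2 * (t + 1) = 2 * (i + j) + 1 - 2 * t by
      intro t; ring]
    linear_combination (-(2 * (i + j) + 3) * 2 ^ (j + 1) * j ! * (2 * i + 1)! *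
      ∏ t ∈ range j, (2 * ((i : ℤ) + j) + 1 - 2 * t)) * hc

theorem prod_range_add_mul_factorial (m i : ℕ) :
    (∏ t ∈ range i, ((m : ℤ) + 1 + t)) * m ! = (m + i)! := by
  induction i with
  | zero => simp
  | succ i ih =>
    rw [prod_range_succ, ← add_assoc, factorial_succ]
    push_cast
    rw [← ih]
    ring

theorem choose_mul_prod_odd (i j : ℕ) :
    ((i + j).choose i : ℤ) * 2 ^ j * (∏ t ∈ range i, (((i + j : ℕ) : ℤ) + 1 + t)) *
        ∏ t ∈ range j, (2 * ((i + j : ℕ) : ℤ) + 1 - 2 * t) =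
      lucasCoeff j (2 * i + 1) * ∏ t ∈ range (i + j), (((i + j : ℕ) : ℤ) + 1 + t) := by
  have h₁ := prod_odd_mul_factorial i j
  have h₂ := prod_range_add_mul_factorial (i + j) i
  have h₃ := prod_range_add_mul_factorial (i + j) (i + j)
  have h₄ : (lucasCoeff j (2 * i + 1) * j ! * (2 * i + 1)! * (j + (2 * i + 1)) : ℤ) =
      (2 * j + (2 * i + 1)) * (j + (2 * i + 1))! := by
    exact_mod_cast lucasCoeff_mul_factorial j (2 * i + 1)
  rw [show j + (2 * i + 1) = i + j + i + 1 by ring, factorial_succ (i + j + i)] at h₄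
  rw [show 2 * (i + j) + 1 = i + j + (i + j) + 1 by ring, factorial_succ (i + j + (i + j))] at h₁
  rw [choose_symm_add]
  generalize (∏ t ∈ range i, (((i + j : ℕ) : ℤ) + 1 + t)) = P at *
  generalize (∏ t ∈ range j, (2 * ((i + j : ℕ) : ℤ) + 1 - 2 * t)) = D at *
  generalize (∏ t ∈ range (i + j), (((i + j : ℕ) : ℤ) + 1 + t)) = Q at *
  have hne : ((i + j)! * j ! * (2 * i + 1)! * (j + (2 * i + 1)) : ℤ) ≠ 0 := by
    exact_mod_cast (by positivity : (i + j)! * j ! * (2 * i + 1)! * (j + (2 * i + 1)) ≠ 0)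
  apply mul_right_cancel₀ hne
  push_cast at *
  linear_combination ((j + (2 * i + 1)) * P * (i + j)!) * h₁ +
    ((j + (2 * i + 1)) * (2 * i + 2 * j + 1) * (i + j + (i + j))!) * h₂ - Q * (i + j)! * h₄ -
    ((2 * j + 2 * i + 1) * (i + j + i + 1) * (i + j + i)!) * h₃

theorem choose_mul_prod_even (i j : ℕ) (hij : i + j ≠ 0) :
    ((i + j).choose i : ℤ) * 2 ^ j * (∏ t ∈ range i, (((i + j : ℕ) : ℤ) + t)) *
        ∏ t ∈ range j, (2 * ((i + j : ℕ) : ℤ) - 1 - 2 * t) =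
      lucasCoeff j (2 * i) * ∏ t ∈ range (i + j), (((i + j : ℕ) : ℤ) + t) := by
  obtain ⟨m, hm⟩ := exists_eq_succ_of_ne_zero hij
  rw [succ_eq_add_one] at hm
  have h₁ := prod_even_mul_factorial i j
  have h₂ := prod_range_add_mul_factorial m i
  have h₃ := prod_range_add_mul_factorial m (m + 1)
  have h₄ : (lucasCoeff j (2 * i) * j ! * (2 * i)! * (j + 2 * i) : ℤ) =
      (2 * j + 2 * i) * (j + 2 * i)! := by
    exact_mod_cast lucasCoeff_mul_factorial j (2 * i)
  rw [choose_symm_add]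
  have hne : (m ! * j ! * (2 * i)! * (j + 2 * i) : ℤ) ≠ 0 := by
    have : 0 < j + 2 * i := by lia
    exact_mod_cast (by positivity : m ! * j ! * (2 * i)! * (j + 2 * i) ≠ 0)
  have hm' : (i : ℤ) + j = m + 1 := by exact_mod_cast hm
  rw [show j + 2 * i = m + i + 1 by lia, factorial_succ] at h₄
  rw [hm, show 2 * (m + 1) = m + (m + 1) + 1 by ring, factorial_succ] at h₁
  rw [hm]
  push_cast at *
  generalize (∏ t ∈ range i, ((m : ℤ) + 1 + t)) = P at *
  generalize (∏ t ∈ range j, (2 * ((m : ℤ) + 1) - 1 - 2 * t)) = D at *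
  generalize (∏ t ∈ range (m + 1), ((m : ℤ) + 1 + t)) = Q at *
  apply mul_right_cancel₀ hne
  rw [show (j : ℤ) + 2 * i = m + i + 1 by linarith] at *
  rw [show 2 * (j : ℤ) + 2 * i = 2 * m + 2 by linarith] at h₄
  linear_combination ((m + i + 1) * P * m !) * h₁ +
    ((m + i + 1) * (2 * m + 2) * (m + (m + 1))!) * h₂ - Q * m ! * h₄ -
    ((2 * m + 2) * (m + i + 1) * (m + i)!) * h₃

theorem prod_Icc_sub_eq_prod_range (N : ℤ) (h : ℕ) :
    ∏ j ∈ Icc 1 h, (N - j) = ∏ t ∈ range h, (N - h + t) := by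
  induction h with
  | zero => simp
  | succ h ih =>
    rw [prod_Icc_succ_top (by lia), ih, prod_range_succ']
    push_cast
    simp only [show ∀ t : ℤ, N - (h + 1) + (t + 1) = N - h + t by intro t; ring, add_zero]

theorem lucasOdd_of_recurrence (h : ℕ) (A : ℕ → ℕ → ℤ) (hA0 : ∀ r, A r 0 = 1)
    (hA : ∀ r k, 1 ≤ k → r + k ≤ h → A r k = (((2 * h + 1 : ℕ) : ℤ) - r - k) * A r (k - 1) +
      4 * (((2 * h + 1 : ℕ) : ℤ) - 2 * r) * A (r + 1) (k - 1)) :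
    A 0 h = (∏ j ∈ Icc 1 h, (((2 * h + 1 : ℕ) : ℤ) - j)) * lucasOdd 1 2 h := by
  rw [sum_paths_of_recurrence (2 * h + 1 : ℕ) 0 1 4 h A hA0
    (fun r k hk hrk ↦ by rw [hA r k hk hrk]; ring) 0 h (by simp), prod_Icc_sub_eq_prod_range,
    lucasOdd, mul_sum]
  refine sum_congr rfl fun ⟨i, j⟩ hij ↦ ?_
  obtain rfl := mem_antidiagonal.1 hij
  have key := choose_mul_prod_odd i j
  push_cast at key ⊢
  simp only [zero_add, one_pow, sub_zero, mul_one, one_mul,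
    show (2 * ((i : ℤ) + j) + 1 - (i + j)) = i + j + 1 by ring]
  rw [show (4 : ℤ) = 2 * 2 by norm_num, mul_pow]
  linear_combination 2 ^ j * key

theorem lucasEven_of_recurrence (h : ℕ) (hh : h ≠ 0) (B : ℕ → ℕ → ℤ) (hB0 : ∀ r, B r 0 = 1)
    (hB : ∀ r k, 1 ≤ k → r + k ≤ h → B r k = -2 * (((2 * h : ℕ) : ℤ) - r - k) * B r (k - 1) -
      2 * (((2 * h : ℕ) : ℤ) - 2 * r - 1) * B (r + 1) (k - 1)) :
    B 0 h = (∏ j ∈ Icc 1 h, (((2 * h : ℕ) : ℤ) - j)) * ((-1) ^ h * lucasEven 2 1 h) := by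
  rw [sum_paths_of_recurrence (2 * h : ℕ) 1 (-2) (-2) h B hB0
    (fun r k hk hrk ↦ by rw [hB r k hk hrk]; ring) 0 h (by simp), prod_Icc_sub_eq_prod_range,
    lucasEven, mul_sum, mul_sum]
  refine sum_congr rfl fun ⟨i, j⟩ hij ↦ ?_
  obtain rfl := mem_antidiagonal.1 hij
  have key := choose_mul_prod_even i j hh
  push_cast at key ⊢
  simp only [zero_add, one_pow, mul_one,
    show (2 * ((i : ℤ) + j) - (i + j)) = i + j by ring]
  rw [show (-2 : ℤ) = -1 * 2 by norm_num, mul_pow, mul_pow, pow_add (-1 : ℤ)]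
  linear_combination (-1) ^ i * (-1) ^ j * 2 ^ i * key

theorem mersenne_prime_iff_dvd_s (p : ℕ) (hp : 3 ≤ p) :
    Nat.Prime (2 ^ p - 1) ↔ (2 ^ p - 1 : ℤ) ∣ LucasLehmer.s (p - 2) := by
  have hiff : Nat.Prime (2 ^ p - 1) ↔ LucasLehmer.LucasLehmerTest p :=
    ⟨lucas_lehmer_necessity p hp, lucas_lehmer_sufficiency p (by lia)⟩
  obtain ⟨m, rfl⟩ := Nat.exists_eq_add_of_le' (show 2 ≤ p by lia)
  rw [hiff, LucasLehmer.LucasLehmerTest, LucasLehmer.lucasLehmerResidue, LucasLehmer.sZMod_eq_s,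
    ZMod.intCast_zmod_eq_zero_iff_dvd]
  simp

theorem lucas_lehmer_moustafa
    (p : ℕ) (hp : p.Prime) (hp5 : 5 ≤ p) (n : ℕ) (hn : n = 2 ^ (p - 1))
    (A B : ℕ → ℕ → ℤ)
    (hA0 : ∀ r, A r 0 = 1)
    (hA : ∀ r k, 1 ≤ k → r + k ≤ p / 2 →
      A r k = ((p : ℤ) - r - k) * A r (k - 1) + 4 * ((p : ℤ) - 2 * r) * A (r + 1) (k - 1))
    (hB0 : ∀ r, B r 0 = 1)
    (hB : ∀ r k, 1 ≤ k → r + k ≤ n / 2 →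
      B r k = -2 * ((n : ℤ) - r - k) * B r (k - 1)
        - 2 * ((n : ℤ) - 2 * r - 1) * B (r + 1) (k - 1)) :
    (∏ j ∈ Finset.Icc 1 (p / 2), ((p : ℤ) - j)) ∣ A 0 (p / 2) ∧
    (∏ j ∈ Finset.Icc 1 (n / 2), ((n : ℤ) - j)) ∣ B 0 (n / 2) ∧
    (Nat.Prime (2 ^ p - 1) ↔
      A 0 (p / 2) / (∏ j ∈ Finset.Icc 1 (p / 2), ((p : ℤ) - j)) ∣
        B 0 (n / 2) / (∏ j ∈ Finset.Icc 1 (n / 2), ((n : ℤ) - j))) := by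
  have hprod : ∀ N h : ℕ, h < N → ∏ j ∈ Icc 1 h, ((N : ℤ) - j) ≠ 0 := fun N h hhN ↦
    prod_ne_zero_iff.2 fun j hj ↦ by have := mem_Icc.1 hj; lia
  have hpodd : p = 2 * (p / 2) + 1 := by
    have := hp.eq_two_or_odd
    lia
  have hn2 : n / 2 = 2 ^ (p - 2) := by
    rw [hn, show p - 1 = p - 2 + 1 by lia, pow_succ, Nat.mul_div_cancel _ two_pos]
  have hneven : n = 2 * (n / 2) := by
    rw [hn2, hn, show p - 1 = p - 2 + 1 by lia, pow_succ, mul_comm]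
  have hn0 : n / 2 ≠ 0 := by rw [hn2]; positivity
  have hAp := lucasOdd_of_recurrence (p / 2) A hA0 (by rwa [← hpodd])
  have hBn := lucasEven_of_recurrence (n / 2) hn0 B hB0 (by rwa [← hneven])
  rw [← hpodd, (lucasEven_and_lucasOdd_one_two _).2, ← hpodd] at hAp
  have hsign : (-1 : ℤ) ^ (n / 2) = 1 := by
    rw [hn2]
    exact Even.neg_one_pow (even_two.pow_of_ne_zero (by lia))
  rw [← hneven, hsign, one_mul, (lucasEven_and_lucasOdd_two_one _).1, hn2,
    ← LucasLehmer.s_eq_two_mul_re, ← hn2] at hBn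
  refine ⟨⟨_, hAp⟩, ⟨_, hBn⟩, ?_⟩
  rw [hAp, hBn, Int.mul_ediv_cancel_left _ (hprod p _ (by lia)),
    Int.mul_ediv_cancel_left _ (hprod n _ (by lia))]
  exact mersenne_prime_iff_dvd_s p (by lia)
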